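/- Let x ∈ M with q(x) ≠ 0 (i.e., x has rank 4). Then there exists g ∈ G(M) with g(x) = (1, 0, diag(1,1,k), 0), where k ∈ F is the unique element with 8k = −q(x). Consequently, for any x, y ∈ M with q(x) = q(y) ≠ 0 there exists g ∈ G(M) with g(x) = y. -/

import Mathlib

open Matrix

namespace Freudenthal

variable (F : Type*) [Field F]

/-- The cubic Jordan algebra `J = M₃(F)`. -/
abbrev Mat := Matrix (Fin 3) (Fin 3) F

/-- The trace bilinear form `(A, B) = tr(A·B)` on `J`. -/
def tb (A B : Mat F) : F := (A * B).trace

/-- The Freudenthal module `M = F ⊕ F ⊕ J ⊕ J`, elements `(α, β, A, B)`. -/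
abbrev FM := F × F × Mat F × Mat F

/-- The quartic norm `q(x) = 8(A#,B#) − 8α·det A − 8β·det B − 2((A,B) − αβ)²`. -/
def qf (x : FM F) : F :=
  8 * tb F x.2.2.1.adjugate x.2.2.2.adjugate - 8 * x.1 * x.2.2.1.det
    - 8 * x.2.1 * x.2.2.2.det - 2 * (tb F x.2.2.1 x.2.2.2 - x.1 * x.2.1) ^ 2

/-- The symplectic form `{x, y} = αδ − βγ + (A,D) − (B,C)`. -/
def symp (x y : FM F) : F :=
  x.1 * y.2.1 - x.2.1 * y.1 + tb F x.2.2.1 y.2.2.2 - tb F x.2.2.2 y.2.2.1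

/-- Membership in the group `G(M)`: invertible `F`-linear transformations of `M`
preserving the quartic norm `q` and the symplectic form `{·,·}`. -/
def InG (g : FM F → FM F) : Prop :=
  IsLinearMap F g ∧ Function.Bijective g ∧
    (∀ x, qf F (g x) = qf F x) ∧ (∀ x y, symp F (g x) (g y) = symp F x y)

end Freudenthal

open Freudenthal

namespace Freudenthal

section
variable {F : Type*} [Field F]

/-- Same orbit. -/
def Rel (x y : FM F) : Prop := ∃ g : FM F → FM F, InG F g ∧ g x = y

theorem Rel.trans {x y z : FM F} (h : Rel x y) (h' : Rel y z) : Rel x z := by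
  obtain ⟨g, ⟨l, b, q, s⟩, rfl⟩ := h
  obtain ⟨g', ⟨l', b', q', s'⟩, rfl⟩ := h'
  refine ⟨g' ∘ g, ⟨?_, b'.comp b, ?_, ?_⟩, rfl⟩
  · exact ((l'.mk' g').comp (l.mk' g)).isLinear
  · intro x; simp [q, q']
  · intro x y; simp [s, s']

theorem Rel.symm {x y : FM F} (h : Rel x y) : Rel y x := by
  obtain ⟨g, ⟨l, b, q, s⟩, rfl⟩ := h
  let e : FM F ≃ₗ[F] FM F := LinearEquiv.ofBijective (l.mk' g) b
  have he : ∀ x, g (e.symm x) = x := fun x => e.apply_symm_apply x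
  refine ⟨e.symm, ⟨e.symm.toLinearMap.isLinear, e.symm.bijective, ?_, ?_⟩, e.symm_apply_apply x⟩
  · intro x; rw [← q, he]
  · intro x y; rw [← s, he, he]

theorem Rel.qf_eq {x y : FM F} (h : Rel x y) : qf F y = qf F x := by
  obtain ⟨g, ⟨l, b, q, s⟩, rfl⟩ := h
  exact q x

/-- The Levi action. -/
theorem rel_levi (P P' Q Q' : Mat F) (c : F) (hP : P * P' = 1) (hQ : Q * Q' = 1)
    (hc : c * (P.det * Q.det) = 1) (α β : F) (A B : Mat F) :
    Rel (α, β, A, B) (c * α, P.det * Q.det * β, P * A * Q, Q' * B * P') := by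
  have hP' : P' * P = 1 := mul_eq_one_comm.mp hP
  have hQ' : Q' * Q = 1 := mul_eq_one_comm.mp hQ
  have dP : P.det * P'.det = 1 := by rw [← det_mul, hP, det_one]
  have dQ : Q.det * Q'.det = 1 := by rw [← det_mul, hQ, det_one]
  have aP : P'.adjugate * P.adjugate = 1 := by rw [← adjugate_mul_distrib, hP, adjugate_one]
  have aQ : Q.adjugate * Q'.adjugate = 1 := by rw [← adjugate_mul_distrib, hQ', adjugate_one]
  have key : ∀ P P' Q Q' A B : Mat F, P' * P = 1 → Q * Q' = 1 →
      tb F (P * A * Q) (Q' * B * P') = tb F A B := by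
    intro P P' Q Q' A B h1 h2
    unfold tb
    rw [show P * A * Q * (Q' * B * P') = P * (A * (Q * Q') * B * P') by simp only [Matrix.mul_assoc],
      trace_mul_comm, h2, Matrix.mul_one, Matrix.mul_assoc, h1, Matrix.mul_one]
  have key' : ∀ P P' Q Q' A B : Mat F, P' * P = 1 → Q * Q' = 1 →
      tb F (Q' * B * P') (P * A * Q) = tb F B A := by
    intro P P' Q Q' A B h1 h2
    have := key P P' Q Q' A B h1 h2
    unfold tb at *
    rw [trace_mul_comm, this, trace_mul_comm]
  refine ⟨fun x => (c * x.1, P.det * Q.det * x.2.1, P * x.2.2.1 * Q, Q' * x.2.2.2 * P'),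
    ⟨⟨?_, ?_⟩, ?_, ?_, ?_⟩, rfl⟩
  · intro x y
    simp [mul_add, add_mul]
  · intro r x
    simp [mul_left_comm]
  · refine Function.bijective_iff_has_inverse.mpr
      ⟨fun x => (P.det * Q.det * x.1, c * x.2.1, P' * x.2.2.1 * Q', Q * x.2.2.2 * P), ?_, ?_⟩
    · rintro ⟨a, b, A, B⟩
      refine Prod.ext ?_ (Prod.ext ?_ (Prod.ext ?_ ?_))
      · change P.det * Q.det * (c * a) = a
        linear_combination a * hc
      · change c * (P.det * Q.det * b) = b
        linear_combination b * hc
      · change P' * (P * A * Q) * Q' = A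
        rw [show P' * (P * A * Q) * Q' = (P' * P) * A * (Q * Q') by simp only [Matrix.mul_assoc],
          hP', hQ]; simp
      · change Q * (Q' * B * P') * P = B
        rw [show Q * (Q' * B * P') * P = (Q * Q') * B * (P' * P) by simp only [Matrix.mul_assoc],
          hP', hQ]; simp
    · rintro ⟨a, b, A, B⟩
      refine Prod.ext ?_ (Prod.ext ?_ (Prod.ext ?_ ?_))
      · change c * (P.det * Q.det * a) = a
        linear_combination a * hc
      · change P.det * Q.det * (c * b) = b
        linear_combination b * hc
      · change P * (P' * A * Q') * Q = A
        rw [show P * (P' * A * Q') * Q = (P * P') * A * (Q' * Q) by simp only [Matrix.mul_assoc],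
          hP, hQ']; simp
      · change Q' * (Q * B * P) * P' = B
        rw [show Q' * (Q * B * P) * P' = (Q' * Q) * B * (P * P') by simp only [Matrix.mul_assoc],
          hP, hQ']; simp
  · rintro ⟨a, b, A, B⟩
    simp only [qf]
    rw [key _ _ _ _ _ _ hP' hQ]
    have : tb F (P * A * Q).adjugate (Q' * B * P').adjugate = tb F A.adjugate B.adjugate := by
      simp only [adjugate_mul_distrib, ← Matrix.mul_assoc]
      simp only [Matrix.mul_assoc]
      simp only [← Matrix.mul_assoc]
      have := key Q.adjugate Q'.adjugate P.adjugate P'.adjugate A.adjugate B.adjugate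
        (by rw [← adjugate_mul_distrib, hQ, adjugate_one])
        (by rw [← adjugate_mul_distrib, hP', adjugate_one])
      simpa only [Matrix.mul_assoc] using this
    rw [this]
    simp only [det_mul]
    have h1 : c * a * (P.det * A.det * Q.det) = a * A.det := by linear_combination a * A.det * hc
    have h2 : P.det * Q.det * b * (Q'.det * B.det * P'.det) = b * B.det := by
      linear_combination b * B.det * (Q.det * Q'.det) * dP + b * B.det * dQ
    have h3 : c * a * (P.det * Q.det * b) = a * b := by linear_combination a * b * hc
    rw [h3]
    linear_combination -8 * h1 - 8 * h2
  · rintro ⟨a, b, A, B⟩ ⟨a', b', A', B'⟩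
    simp only [symp]
    rw [key _ _ _ _ _ _ hP' hQ, key' _ _ _ _ _ _ hP' hQ]
    linear_combination (a * b' - b * a') * hc

theorem rel_swap (α β : F) (A B : Mat F) : Rel (α, β, A, B) (-β, α, -B, A) := by
  refine ⟨fun x => (-x.2.1, x.1, -x.2.2.2, x.2.2.1), ⟨⟨?_, ?_⟩, ?_, ?_, ?_⟩, rfl⟩
  · intro x y
    simp [add_comm]
  · intro r x
    simp
  · refine Function.bijective_iff_has_inverse.mpr
      ⟨fun x => (x.2.1, -x.1, x.2.2.2, -x.2.2.1), ?_, ?_⟩ <;> intro x <;> simp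
  · rintro ⟨a, b, A, B⟩
    simp only [qf, tb, trace_fin_three, adjugate_fin_three, det_fin_three, Matrix.mul_apply,
      Fin.sum_univ_three, Matrix.neg_apply, Matrix.of_apply, Matrix.cons_val]
    ring
  · rintro ⟨a, b, A, B⟩ ⟨a', b', A', B'⟩
    simp only [symp, tb, trace_fin_three, Matrix.mul_apply,
      Fin.sum_univ_three, Matrix.neg_apply]
    ring

/-- `E₀₀ × A`. -/
def cr (A : Mat F) : Mat F := !![0, 0, 0; 0, A 2 2, - A 1 2; 0, - A 2 1, A 1 1]

/-- `E₀₀`. -/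
def e0 : Mat F := !![1, 0, 0; 0, 0, 0; 0, 0, 0]

def phi (t : F) (x : FM F) : FM F :=
  (x.1 + t * x.2.2.2 0 0, x.2.1, x.2.2.1 + (t * x.2.1) • e0, x.2.2.2 + t • cr x.2.2.1)

theorem phi_phi (t : F) (x : FM F) : phi (-t) (phi t x) = x := by
  obtain ⟨a, b, A, B⟩ := x
  refine Prod.ext ?_ (Prod.ext ?_ (Prod.ext ?_ ?_))
  · simp [phi, cr]
  · simp [phi]
  · ext i j; simp [phi]
  · ext i j; fin_cases i <;> fin_cases j <;> simp [phi, cr, e0]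

set_option maxHeartbeats 4000000 in
theorem phi_inG (t : F) : InG F (phi t) := by
  refine ⟨⟨?_, ?_⟩, ?_, ?_, ?_⟩
  · rintro ⟨a, b, A, B⟩ ⟨a', b', A', B'⟩
    refine Prod.ext ?_ (Prod.ext ?_ (Prod.ext ?_ ?_))
    · simp [phi]; ring
    · simp [phi]
    · ext i j; simp [phi]; ring
    · ext i j; fin_cases i <;> fin_cases j <;> simp [phi, cr] <;> ring
  · rintro r ⟨a, b, A, B⟩
    refine Prod.ext ?_ (Prod.ext ?_ (Prod.ext ?_ ?_))
    · simp [phi]; ring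
    · simp [phi]
    · ext i j; simp [phi]; ring
    · ext i j; fin_cases i <;> fin_cases j <;> simp [phi, cr] <;> ring
  · refine Function.bijective_iff_has_inverse.mpr ⟨phi (-t), phi_phi t, ?_⟩
    intro x
    simpa using phi_phi (-t) x
  · rintro ⟨a, b, A, B⟩
    simp only [phi, cr, e0, qf, tb, trace_fin_three, adjugate_fin_three, det_fin_three,
      Matrix.mul_apply, Fin.sum_univ_three, Matrix.add_apply, Matrix.smul_apply, smul_eq_mul,
      Matrix.of_apply, Matrix.cons_val]
    ring
  · rintro ⟨a, b, A, B⟩ ⟨a', b', A', B'⟩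
    simp only [phi, cr, e0, symp, tb, trace_fin_three,
      Matrix.mul_apply, Fin.sum_univ_three, Matrix.add_apply, Matrix.smul_apply, smul_eq_mul,
      Matrix.of_apply, Matrix.cons_val]
    ring

theorem rel_phi (t α β : F) (A B : Mat F) :
    Rel (α, β, A, B) (α + t * B 0 0, β, A + (t * β) • e0, B + t • cr A) :=
  ⟨phi t, phi_inG t, rfl⟩

theorem cr_neg (A : Mat F) : cr (-A) = - cr A := by
  ext i j; fin_cases i <;> fin_cases j <;> simp [cr]

theorem rel_psi (t α β : F) (A B : Mat F) :
    Rel (α, β, A, B) (α, β + t * A 0 0, A + t • cr B, B + (t * α) • e0) := by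
  have h1 := rel_swap α β A B
  have h2 := rel_phi (-t) (-β) α (-B) A
  have h3 := (rel_swap α (β + t * A 0 0) (A + t • cr B) (B + (t * α) • e0)).symm
  refine (h1.trans h2).trans ?_
  convert h3 using 2
  · ring
  · congr 2
    · rw [neg_mul, neg_smul, neg_add]
    · rw [cr_neg, neg_smul, smul_neg, neg_neg]

/-- diagonal matrices -/
abbrev dg (a b c : F) : Mat F := diagonal ![a, b, c]

theorem dg_eq (a b c : F) : dg a b c = !![a, 0, 0; 0, b, 0; 0, 0, c] := by
  ext i j; fin_cases i <;> fin_cases j <;> simp [dg]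

theorem rel_rot (α β : F) (A : Mat F) (a b c : F) :
    ∃ A', Rel (α, β, A, dg a b c) (α, β, A', dg b c a) ∧
      ∀ x y z, A = dg x y z → A' = dg y z x := by
  let P : Mat F := !![0, 1, 0; 0, 0, 1; 1, 0, 0]
  let P' : Mat F := !![0, 0, 1; 1, 0, 0; 0, 1, 0]
  have h1 : P * P' = 1 := by
    ext i j; fin_cases i <;> fin_cases j <;> simp [P, P', Matrix.mul_apply, Fin.sum_univ_three]
  have h2 : P' * P = 1 := mul_eq_one_comm.mp h1
  have d : P.det * P'.det = 1 := by rw [← det_mul, h1, det_one]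
  have h := rel_levi P P' P' P 1 h1 h2 (by rw [d, one_mul]) α β A (dg a b c)
  have rot : ∀ x y z : F, P * dg x y z * P' = dg y z x := by
    intro x y z
    rw [dg_eq, dg_eq]
    ext i j; fin_cases i <;> fin_cases j <;> simp [P, P', Matrix.mul_apply, Fin.sum_univ_three]
  rw [d, one_mul, one_mul, rot] at h
  exact ⟨_, h, by rintro x y z rfl; exact rot x y z⟩

theorem rel_rot_dg (α β x y z a b c : F) :
    Rel (α, β, dg x y z, dg a b c) (α, β, dg y z x, dg b c a) := by
  obtain ⟨A', h, h'⟩ := rel_rot α β (dg x y z) a b c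
  rwa [h' _ _ _ rfl] at h

theorem exists_diag (A : Mat F) : ∃ P P' Q Q' : Mat F, ∃ a b c : F,
    P * P' = 1 ∧ Q * Q' = 1 ∧ P.det = 1 ∧ Q.det = 1 ∧ P * A * Q = dg a b c := by
  obtain ⟨L, L', D, h⟩ := Matrix.Pivot.exists_list_transvec_mul_mul_list_transvec_eq_diagonal A
  have hL : ((L.map TransvectionStruct.toMatrix).prod).det = 1 :=
    TransvectionStruct.det_toMatrix_prod L
  have hL' : ((L'.map TransvectionStruct.toMatrix).prod).det = 1 :=
    TransvectionStruct.det_toMatrix_prod L'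
  refine ⟨_, _, _, _, D 0, D 1, D 2, mul_nonsing_inv _ (by rw [hL]; exact isUnit_one),
    mul_nonsing_inv _ (by rw [hL']; exact isUnit_one), hL, hL', ?_⟩
  rw [h]
  congr 1
  ext i; fin_cases i <;> rfl

theorem rel_diagA (α β : F) (A : Mat F) : ∃ a b c, Rel (α, β, A, 0) (α, β, dg a b c, 0) := by
  obtain ⟨P, P', Q, Q', a, b, c, h1, h2, d1, d2, h⟩ := exists_diag A
  have := rel_levi P P' Q Q' 1 h1 h2 (by simp [d1, d2]) α β A 0
  refine ⟨a, b, c, ?_⟩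
  simpa [d1, d2, h] using this

theorem rel_diagB (α β : F) (A B : Mat F) :
    ∃ A' a b c, Rel (α, β, A, B) (α, β, A', dg a b c) := by
  obtain ⟨P, P', Q, Q', a, b, c, h1, h2, d1, d2, h⟩ := exists_diag B
  have d1' : P'.det = 1 := by have := congrArg det h1; simpa [d1] using this
  have d2' : Q'.det = 1 := by have := congrArg det h2; simpa [d2] using this
  have := rel_levi Q' Q P' P 1 (mul_eq_one_comm.mp h2) (mul_eq_one_comm.mp h1)
    (by simp [d1', d2']) α β A B
  refine ⟨Q' * A * P', a, b, c, ?_⟩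
  simpa [d1', d2', h] using this

theorem tb_zero (A : Mat F) : tb F A 0 = 0 := by simp [tb]

theorem adj_zero : (0 : Mat F).adjugate = 0 := by
  ext i j; fin_cases i <;> fin_cases j <;> simp [adjugate_fin_three]

theorem qf_special (α β : F) (A : Mat F) :
    qf F (α, β, A, 0) = -8 * α * A.det - 2 * (α * β) ^ 2 := by
  simp [qf, tb_zero, adj_zero]

theorem rel_scale (α β : F) (A B : Mat F) (h : α ≠ 0) :
    ∃ β' A' B', Rel (α, β, A, B) (1, β', A', B') := by
  have := rel_levi (dg α 1 1) (dg α⁻¹ 1 1) 1 1 α⁻¹ ?_ (by simp) ?_ α β A B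
  · rw [inv_mul_cancel₀ h] at this
    exact ⟨_, _, _, this⟩
  · rw [dg_eq, dg_eq]
    ext i j; fin_cases i <;> fin_cases j <;> simp [Matrix.mul_apply, Fin.sum_univ_three, h]
  · simp [dg, Fin.prod_univ_three, h]

/-- make the first coordinate one -/
theorem step1 (x : FM F) (hx : qf F x ≠ 0) : ∃ β A B, Rel x (1, β, A, B) := by
  obtain ⟨α, β, A, B⟩ := x
  by_cases h : α = 0
  · subst h
    obtain ⟨A', a, b, c, h⟩ := rel_diagB 0 β A B
    have fin : ∀ A' a b c, Rel (0, β, A, B) (0, β, A', dg a b c) → a ≠ 0 →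
        ∃ β' A' B', Rel (0, β, A, B) (1, β', A', B') := by
      intro A' a b c h ha
      have h2 := rel_phi 1 0 β A' (dg a b c)
      obtain ⟨_, _, _, h3⟩ := rel_scale (0 + 1 * dg a b c 0 0) β (A' + (1 * β) • e0)
        (dg a b c + (1 : F) • cr A') (by simpa [dg] using ha)
      exact ⟨_, _, _, (h.trans h2).trans h3⟩
    by_cases ha : a = 0
    · obtain ⟨A2, h2, -⟩ := rel_rot 0 β A' a b c
      by_cases hb : b = 0
      · obtain ⟨A3, h3, -⟩ := rel_rot 0 β A2 b c a
        by_cases hc : c = 0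
        · exfalso
          apply hx
          rw [← h.qf_eq]
          have : dg a b c = 0 := by
            rw [dg_eq, ha, hb, hc]
            ext i j; fin_cases i <;> fin_cases j <;> simp
          rw [this, qf_special]
          ring
        · exact fin _ _ _ _ ((h.trans h2).trans h3) hc
      · exact fin _ _ _ _ (h.trans h2) hb
    · exact fin _ _ _ _ h ha
  · exact rel_scale _ _ _ _ h

theorem dg_add_e0 (a b c t : F) : dg a b c + t • e0 = dg (a + t) b c := by
  rw [dg_eq, dg_eq]
  ext i j; fin_cases i <;> fin_cases j <;> simp [e0]

theorem dg_add_cr (a b c t x y z : F) :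
    dg a b c + t • cr (dg x y z) = dg a (b + t * z) (c + t * y) := by
  rw [dg_eq, dg_eq, dg_eq]
  ext i j; fin_cases i <;> fin_cases j <;> simp [cr]

theorem dg_zero : dg (0 : F) 0 0 = 0 := by
  rw [dg_eq]
  ext i j; fin_cases i <;> fin_cases j <;> simp

/-- kill `B` -/
theorem step2 (β : F) (A B : Mat F) : ∃ β' A', Rel (1, β, A, B) (1, β', A', 0) := by
  obtain ⟨A1, a, b, c, h⟩ := rel_diagB 1 β A B
  have kill : ∀ (β : F) (A : Mat F) (a b c : F),
      ∃ β' A', Rel (1, β, A, dg a b c) (1, β', A', dg b c 0) := by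
    intro β A a b c
    have h1 := rel_psi (-a) 1 β A (dg a b c)
    rw [dg_add_e0, show a + -a * 1 = 0 by ring] at h1
    obtain ⟨A', h2, -⟩ := rel_rot 1 (β + -a * A 0 0) (A + (-a) • cr (dg a b c)) 0 b c
    exact ⟨_, _, h1.trans h2⟩
  obtain ⟨β2, A2, h2⟩ := kill β A1 a b c
  obtain ⟨β3, A3, h3⟩ := kill β2 A2 b c 0
  obtain ⟨β4, A4, h4⟩ := kill β3 A3 c 0 0
  rw [dg_zero] at h4
  exact ⟨_, _, h.trans (h2.trans (h3.trans h4))⟩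

theorem rot0 (β a b c : F) : Rel (1, β, dg a b c, 0) (1, β, dg b c a, 0) := by
  have := rel_rot_dg 1 β a b c 0 0 0
  rwa [dg_zero] at this

theorem rel_of_eq {x y z : FM F} (h : Rel x y) (e : y = z) : Rel x z := e ▸ h

theorem T0 (t β a b c : F) : Rel (1, β, dg a b c, 0)
    (1, β - 2 * t * b * c, dg (a + β * t - t ^ 2 * b * c) b c, 0) := by
  have h1 := rel_phi t 1 β (dg a b c) (dg 0 0 0)
  rw [dg_add_e0, dg_add_cr] at h1
  have h1' : Rel (1, β, dg a b c, dg 0 0 0) (1, β, dg (a + t * β) b c, dg 0 (t * c) (t * b)) := by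
    simpa [dg] using h1
  have h2 := rel_rot_dg 1 β (a + t * β) b c 0 (t * c) (t * b)
  have h3 := rel_psi (-(t * c)) 1 β (dg b c (a + t * β)) (dg (t * c) (t * b) 0)
  rw [dg_add_e0, dg_add_cr] at h3
  have h4 := rel_rot_dg 1 (β + -(t * c) * b) b (c + -(t * c) * 0)
    (a + t * β + -(t * c) * (t * b)) 0 (t * b) 0
  have h3' : Rel (1, β, dg b c (a + t * β), dg (t * c) (t * b) 0)
      (1, β + -(t * c) * b, dg b (c + -(t * c) * 0) (a + t * β + -(t * c) * (t * b)),
        dg 0 (t * b) 0) := by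
    refine rel_of_eq h3 ?_
    simp [dg]
  have h5 := rel_psi (-(t * b)) 1 (β + -(t * c) * b) (dg (c + -(t * c) * 0)
    (a + t * β + -(t * c) * (t * b)) b) (dg (t * b) 0 0)
  rw [dg_add_e0, dg_add_cr] at h5
  have h6 := (((h1'.trans h2).trans h3').trans h4).trans h5
  rw [show t * b + -(t * b) * 1 = 0 by ring] at h6
  have h7 := h6.trans (rel_rot_dg _ _ _ _ _ _ _ _)
  rw [dg_zero] at h7
  refine rel_of_eq h7 ?_
  refine Prod.ext rfl (Prod.ext ?_ (Prod.ext ?_ rfl))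
  · simp [dg]; ring
  · change dg _ _ _ = dg _ _ _
    congr 1 <;> ring

/-- the orbit meets `β = 0`, `A` diagonal -/
def Good (x : FM F) : Prop := ∃ a b c, Rel x (1, 0, dg a b c, 0)

theorem Good.of {x y : FM F} (h : Rel x y) (g : Good y) : Good x := by
  obtain ⟨a, b, c, g⟩ := g
  exact ⟨a, b, c, h.trans g⟩

theorem good_bc (h2 : (2 : F) ≠ 0) (β a b c : F) (hb : b ≠ 0) (hc : c ≠ 0) :
    Good (1, β, dg a b c, 0) := by
  have h := T0 (β / (2 * b * c)) β a b c
  rw [show β - 2 * (β / (2 * b * c)) * b * c = 0 by field_simp; ring] at h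
  exact ⟨_, _, _, h⟩

theorem good_ca (h2 : (2 : F) ≠ 0) (β a b c : F) (hc : c ≠ 0) (ha : a ≠ 0) :
    Good (1, β, dg a b c, 0) := (good_bc h2 β b c a hc ha).of (rot0 β a b c)

theorem good_ab (h2 : (2 : F) ≠ 0) (β a b c : F) (ha : a ≠ 0) (hb : b ≠ 0) :
    Good (1, β, dg a b c, 0) := (good_ca h2 β b c a ha hb).of (rot0 β a b c)

/-- bring `a` to something nonzero: at most one nonzero entry -/
theorem good_a (h2 : (2 : F) ≠ 0) (β a : F) (hβ : β ≠ 0) (ha : a ≠ 0) :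
    Good (1, β, dg a 0 0, 0) := by
  have h := (rot0 β a 0 0).trans (T0 1 β 0 0 a)
  refine Good.of h (good_ca h2 _ _ _ _ ha ?_)
  simpa using hβ

theorem good_any (h2 : (2 : F) ≠ 0) (β a b c : F)
    (hq : qf F (1, β, dg a b c, 0) ≠ 0) : Good (1, β, dg a b c, 0) := by
  by_cases hβ : β = 0
  · subst hβ
    exact ⟨a, b, c, by simpa using T0 0 0 a b c⟩
  by_cases ha : a = 0
  · by_cases hb : b = 0
    · by_cases hc : c = 0
      · subst ha hb hc
        have h := T0 1 β 0 0 0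
        rw [show β - 2 * 1 * 0 * 0 = β by ring, show 0 + β * 1 - 1 ^ 2 * 0 * 0 = β by ring] at h
        exact (good_a h2 β β hβ hβ).of h
      · subst ha hb
        exact (good_a h2 β c hβ hc).of ((rot0 β 0 0 c).trans (rot0 β 0 c 0))
    · by_cases hc : c = 0
      · subst ha hc
        exact (good_a h2 β b hβ hb).of (rot0 β 0 b 0)
      · exact good_bc h2 _ _ _ _ hb hc
  · by_cases hb : b = 0
    · by_cases hc : c = 0
      · subst hb hc
        exact good_a h2 β a hβ ha
      · exact good_ca h2 _ _ _ _ hc ha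
    · exact good_ab h2 _ _ _ _ ha hb

theorem canon (h2 : (2 : F) ≠ 0) (x : FM F) (hx : qf F x ≠ 0) :
    ∃ k : F, 8 * k = -(qf F x) ∧ Rel x (1, 0, dg 1 1 k, 0) := by
  obtain ⟨β, A, B, r1⟩ := step1 x hx
  obtain ⟨β', A', r2⟩ := step2 β A B
  obtain ⟨a, b, c, r3⟩ := rel_diagA 1 β' A'
  have r := (r1.trans r2).trans r3
  obtain ⟨a, b, c, r4⟩ := good_any h2 β' a b c (by rwa [r.qf_eq])
  have r := r.trans r4
  have hq := r.qf_eq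
  rw [qf_special] at hq
  have hd : (dg a b c).det = a * b * c := by simp [dg, Fin.prod_univ_three]
  rw [hd] at hq
  have ha : a ≠ 0 := by rintro rfl; apply hx; rw [← hq]; ring
  have hb : b ≠ 0 := by rintro rfl; apply hx; rw [← hq]; ring
  refine ⟨a * b * c, by rw [← hq]; ring, r.trans ?_⟩
  have hdet : (dg a⁻¹ b⁻¹ (a * b)).det = 1 := by
    simp [dg, Fin.prod_univ_three]; field_simp
  have h := rel_levi (dg a⁻¹ b⁻¹ (a * b)) (dg a b (a * b)⁻¹) 1 1 1 ?_ (by simp)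
    (by rw [hdet]; simp) 1 0 (dg a b c) 0
  · refine rel_of_eq h ?_
    refine Prod.ext (by simp) (Prod.ext (by simp) (Prod.ext ?_ (by simp)))
    change dg a⁻¹ b⁻¹ (a * b) * dg a b c * 1 = dg 1 1 (a * b * c)
    rw [dg_eq, dg_eq, dg_eq]
    ext i j; fin_cases i <;> fin_cases j <;> simp [Matrix.mul_apply, Fin.sum_univ_three, ha, hb]
  · rw [dg_eq, dg_eq]
    ext i j; fin_cases i <;> fin_cases j <;> simp [Matrix.mul_apply, Fin.sum_univ_three, ha, hb]
    field_simp

end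

end Freudenthal

/-- **Canonical form for elements of rank 4** in `M = F ⊕ F ⊕ M₃(F) ⊕ M₃(F)`
(char `F ≠ 2, 3`): if `q(x) ≠ 0` then `x` can be brought by `G(M)` to
`(1, 0, diag(1,1,k), 0)` where `8k = −q(x)`; consequently `G(M)` acts transitively
on elements of any given nonzero norm. -/
theorem rank_four_orbits_field (F : Type*) [Field F] (h2 : (2 : F) ≠ 0) (h3 : (3 : F) ≠ 0) :
    (∀ x : FM F, qf F x ≠ 0 →
      ∃ (g : FM F → FM F) (k : F), InG F g ∧ 8 * k = -(qf F x) ∧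
        g x = (1, 0, Matrix.diagonal ![1, 1, k], 0)) ∧
    (∀ x y : FM F, qf F x = qf F y → qf F x ≠ 0 →
      ∃ g : FM F → FM F, InG F g ∧ g x = y) := by
  refine ⟨fun x hx => ?_, fun x y hxy hx => ?_⟩
  · obtain ⟨k, hk, g, hg, h⟩ := canon h2 x hx
    exact ⟨g, k, hg, hk, h⟩
  · obtain ⟨k, hk, r⟩ := canon h2 x hx
    obtain ⟨k', hk', r'⟩ := canon h2 y (hxy ▸ hx)
    have h8 : (8 : F) ≠ 0 := by
      rw [show (8 : F) = 2 ^ 3 by norm_num]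
      exact pow_ne_zero _ h2
    have : k = k' := mul_left_cancel₀ h8 (by rw [hk, hk', hxy])
    subst this
    exact r.trans r'.symm
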